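/- Let A, B, C be disks in the plane such that C is disjoint from A and from B, with |center(C) center(A)| > r_C + r_A and |center(C) center(B)| > r_C + r_B, and with |center(A) center(B)| > r_A + r_B. Then there exists a set R of at most two points of the plane that represents C with respect to A and B: for every disk F = (c,ρ) with ρ ≥ 0 tangent to both A and B, if F ∩ C ≠ ∅ then F ∩ R ≠ ∅. -/

import Mathlib

abbrev Pt : Type := EuclideanSpace ℝ (Fin 2)

/-- The Lorentzian form on `ℝ⁴` for which disks in the plane correspond to unit vectors and points
to null vectors (Lie's hyperspherical coordinates). -/
noncomputable def lorentz (v w : Fin 4 → ℝ) : ℝ :=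
  v 0 * w 0 + v 1 * w 1 - (v 2 * w 3 + v 3 * w 2) / 2

/-- The vector of the disk with center `p` and radius `r`. -/
noncomputable def diskVec (p : Pt) (r : ℝ) : Fin 4 → ℝ :=
  ![p 0 / r, p 1 / r, 1 / r, (p 0 ^ 2 + p 1 ^ 2 - r ^ 2) / r]

theorem lorentz_comm (v w : Fin 4 → ℝ) : lorentz v w = lorentz w v := by
  simp only [lorentz]; ring

theorem lorentz_add_left (u v w : Fin 4 → ℝ) :
    lorentz (u + v) w = lorentz u w + lorentz v w := by
  simp only [lorentz, Pi.add_apply]; ring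

theorem lorentz_add_right (u v w : Fin 4 → ℝ) :
    lorentz w (u + v) = lorentz w u + lorentz w v := by
  simp only [lorentz, Pi.add_apply]; ring

theorem lorentz_smul_left (t : ℝ) (v w : Fin 4 → ℝ) :
    lorentz (t • v) w = t * lorentz v w := by
  simp only [lorentz, Pi.smul_apply, smul_eq_mul]; ring

theorem dist_sq_eq (p q : Pt) : dist p q ^ 2 = (p 0 - q 0) ^ 2 + (p 1 - q 1) ^ 2 := by
  rw [EuclideanSpace.dist_eq, Real.sq_sqrt (by positivity)]
  simp [Fin.sum_univ_two, Real.dist_eq, sq_abs]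

theorem lorentz_diskVec (p q : Pt) {r s : ℝ} (hr : r ≠ 0) (hs : s ≠ 0) :
    lorentz (diskVec p r) (diskVec q s) = (r ^ 2 + s ^ 2 - dist p q ^ 2) / (2 * r * s) := by
  rw [dist_sq_eq]
  simp [lorentz, diskVec]
  field_simp
  ring

theorem lorentz_diskVec_self (p : Pt) {r : ℝ} (hr : r ≠ 0) :
    lorentz (diskVec p r) (diskVec p r) = 1 := by
  rw [lorentz_diskVec p p hr hr, dist_self]
  field_simp
  ring

theorem lorentz_diskVec_lt_neg_one {p q : Pt} {r s : ℝ} (hr : 0 < r) (hs : 0 < s)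
    (h : r + s < dist p q) : lorentz (diskVec p r) (diskVec q s) < -1 := by
  rw [lorentz_diskVec p q hr.ne' hs.ne', div_lt_iff₀ (by positivity)]
  nlinarith

theorem lorentz_diskVec_of_tangent {p q : Pt} {r s : ℝ} (hr : 0 < r) (hs : 0 < s)
    (h : dist p q = r + s) : lorentz (diskVec p r) (diskVec q s) = -1 := by
  rw [lorentz_diskVec p q hr.ne' hs.ne', h]
  field_simp
  ring

theorem neg_one_le_lorentz_diskVec {p q : Pt} {r s : ℝ} (hr : 0 < r) (hs : 0 < s)
    (h : dist p q ≤ r + s) : -1 ≤ lorentz (diskVec p r) (diskVec q s) := by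
  rw [lorentz_diskVec p q hr.ne' hs.ne', le_div_iff₀ (by positivity)]
  nlinarith [dist_nonneg (x := p) (y := q)]

/-- A null vector with nonzero weight `n 2` is a multiple of the null vector of a point. -/
theorem lorentz_diskVec_of_null {n : Fin 4 → ℝ} (hn : lorentz n n = 0) (hw : n 2 ≠ 0)
    (q : Pt) {r : ℝ} (hr : r ≠ 0) :
    lorentz n (diskVec q r) =
      n 2 * (r ^ 2 - dist q !₂[n 0 / n 2, n 1 / n 2] ^ 2) / (2 * r) := by
  have hz : n 3 = (n 0 ^ 2 + n 1 ^ 2) / n 2 := by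
    rw [eq_div_iff hw]; simp only [lorentz] at hn; linarith
  rw [dist_sq_eq]
  simp only [lorentz, diskVec, hz]
  simp
  field_simp
  ring

/-- The generalized cross product of three vectors of `ℝ⁴` with respect to `lorentz`. -/
theorem exists_lorentz_cross (A B C : Fin 4 → ℝ) :
    ∃ E : Fin 4 → ℝ, lorentz E A = 0 ∧ lorentz E B = 0 ∧ lorentz E C = 0 ∧
      lorentz E E = -4 * Matrix.det
        !![lorentz A A, lorentz A B, lorentz A C;
           lorentz B A, lorentz B B, lorentz B C;
           lorentz C A, lorentz C B, lorentz C C] ∧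
      ∀ F : Fin 4 → ℝ, lorentz E F ^ 2 = -4 * Matrix.det
        !![lorentz F F, lorentz F A, lorentz F B, lorentz F C;
           lorentz A F, lorentz A A, lorentz A B, lorentz A C;
           lorentz B F, lorentz B A, lorentz B B, lorentz B C;
           lorentz C F, lorentz C A, lorentz C B, lorentz C C] := by
  let d (i j k : Fin 4) : ℝ := Matrix.det !![A i, A j, A k; B i, B j, B k; C i, C j, C k]
  refine ⟨![d 1 2 3, -d 0 2 3, 2 * d 0 1 2, -2 * d 0 1 3], ?_, ?_, ?_, ?_, fun F ↦ ?_⟩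
  · simp [lorentz, d, Matrix.det_fin_three]; ring
  · simp [lorentz, d, Matrix.det_fin_three]; ring
  · simp [lorentz, d, Matrix.det_fin_three]; ring
  · simp [lorentz, d, Matrix.det_fin_three]; ring
  · have hE : lorentz ![d 1 2 3, -d 0 2 3, 2 * d 0 1 2, -2 * d 0 1 3] F =
        Matrix.det (Matrix.of ![F, A, B, C]) := by
      rw [Matrix.det_succ_row_zero]
      simp [lorentz, d, Fin.sum_univ_four, Matrix.det_fin_three, Fin.succAbove]
      ring
    have hg : Matrix.det (!![1, 0, 0, 0; 0, 1, 0, 0; 0, 0, 0, -1 / 2; 0, 0, -1 / 2, 0] :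
        Matrix (Fin 4) (Fin 4) ℝ) = -1 / 4 := by
      rw [Matrix.det_succ_row_zero]
      simp [Fin.sum_univ_four, Matrix.det_fin_three, Fin.succAbove]
      norm_num
    have hG : !![lorentz F F, lorentz F A, lorentz F B, lorentz F C;
           lorentz A F, lorentz A A, lorentz A B, lorentz A C;
           lorentz B F, lorentz B A, lorentz B B, lorentz B C;
           lorentz C F, lorentz C A, lorentz C B, lorentz C C] =
        Matrix.of ![F, A, B, C] *
          !![1, 0, 0, 0; 0, 1, 0, 0; 0, 0, 0, -1 / 2; 0, 0, -1 / 2, 0] *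
          (Matrix.of ![F, A, B, C]).transpose := by
      ext i j
      fin_cases i <;> fin_cases j <;>
        simp [Matrix.mul_apply, Fin.sum_univ_four, lorentz, Matrix.vecHead, Matrix.vecTail] <;> ring
    rw [hG, Matrix.det_mul, Matrix.det_mul, Matrix.det_transpose, hg, hE]
    ring

theorem sq_le_of_tangency_gram {α β γ h : ℝ} (hα : 1 < α) (hβ : 1 < β) (hγ : 1 < γ)
    (hh : -1 ≤ h) {T q : ℝ}
    (hT : T = (1 + β) * (2 + α + γ - h * (α + γ + 2 * α * γ)) - (α - γ) ^ 2 * (1 + h))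
    (hq : q = (1 + β) * (1 + β + 2 * α * γ - 2 * h * (α + γ) + h ^ 2 * (1 - β)))
    (hpos : 0 < T) : T ^ 2 ≤ 2 * (1 + α) * (1 + β) * (1 + γ) * q := by
  have hαγ : 1 < α * γ := by nlinarith
  have h1 : h < 1 := by
    by_contra! h1
    have e1 : 2 + α + γ - h * (α + γ + 2 * α * γ) ≤ 0 := by nlinarith
    have e2 : 0 ≤ (α - γ) ^ 2 * (1 + h) := mul_nonneg (sq_nonneg _) (by linarith)
    nlinarith
  have hTq : T ≤ q := by
    have e : q - T = (1 + h) *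
        ((1 + β) * ((2 * α * γ - α - γ) + (β - 1) * (1 - h)) + (α - γ) ^ 2) := by
      rw [hT, hq]; ring
    have e1 : 0 ≤ 2 * α * γ - α - γ := by nlinarith
    have e2 : 0 ≤ (β - 1) * (1 - h) := mul_nonneg (by linarith) (by linarith)
    have e3 : 0 ≤ q - T := by
      rw [e]
      exact mul_nonneg (by linarith) (add_nonneg (mul_nonneg (by linarith) (by linarith))
        (sq_nonneg _))
    linarith
  have hTP : T ≤ 2 * (1 + α) * (1 + β) * (1 + γ) := by
    have e : 2 * (1 + α) * (1 + β) * (1 + γ) - T = (1 + h) *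
        ((1 + β) * (α + γ + 2 * (α * γ)) + (α - γ) ^ 2) := by
      rw [hT]; ring
    have e3 : 0 ≤ 2 * (1 + α) * (1 + β) * (1 + γ) - T := by
      rw [e]
      exact mul_nonneg (by linarith) (add_nonneg (mul_nonneg (by linarith) (by linarith))
        (sq_nonneg _))
    linarith
  rw [sq]
  exact mul_le_mul hTP hTq hpos.le (by positivity)

/-- Among the generalized disks tangent to three pairwise disjoint disks `A`, `B`, `C` there are two,
`G₁` and `G₂`, such that every disk tangent to `A` and `B` that meets `C` contains the tangency
point of `G₁` and `C` or that of `G₂` and `C`. -/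
theorem exists_two_tangent_vectors {A B C : Fin 4 → ℝ}
    (hA : lorentz A A = 1) (hB : lorentz B B = 1) (hC : lorentz C C = 1)
    (hAB : lorentz A B < -1) (hAC : lorentz A C < -1) (hBC : lorentz B C < -1) :
    ∃ G : Bool → Fin 4 → ℝ,
      (∀ i, lorentz (G i) (G i) = 1 ∧ lorentz (G i) A = -1 ∧ lorentz (G i) B = -1 ∧
        lorentz (G i) C = -1) ∧
      ∀ F : Fin 4 → ℝ, lorentz F F = 1 → lorentz F A = -1 → lorentz F B = -1 →
        -1 ≤ lorentz F C → ∃ i, 0 ≤ lorentz (G i + C) F := by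
  obtain ⟨E, hEA, hEB, hEC, hEE, hEF⟩ := exists_lorentz_cross A B C
  obtain ⟨β, hβ⟩ : ∃ β, lorentz A B = -β := ⟨_, (neg_neg _).symm⟩
  obtain ⟨α, hα⟩ : ∃ α, lorentz A C = -α := ⟨_, (neg_neg _).symm⟩
  obtain ⟨γ, hγ⟩ : ∃ γ, lorentz B C = -γ := ⟨_, (neg_neg _).symm⟩
  have hβ' : lorentz B A = -β := by rw [lorentz_comm, hβ]
  have hα' : lorentz C A = -α := by rw [lorentz_comm, hα]
  have hγ' : lorentz C B = -γ := by rw [lorentz_comm, hγ]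
  have hβ1 : 1 < β := by linarith
  have hα1 : 1 < α := by linarith
  have hγ1 : 1 < γ := by linarith
  obtain ⟨Δ, hΔ⟩ : ∃ Δ, Δ = α ^ 2 + β ^ 2 + γ ^ 2 + 2 * α * β * γ - 1 := ⟨_, rfl⟩
  have hΔ0 : 0 < Δ := by
    have : 0 < 2 * α * β * γ := by positivity
    nlinarith
  have hEE' : lorentz E E = 4 * Δ := by
    rw [hEE, Matrix.det_fin_three]
    simp [hA, hB, hC, hα, hβ, hγ, hα', hβ', hγ', hΔ]
    ring
  obtain ⟨P, hP⟩ : ∃ P, P = 2 * (1 + α) * (1 + β) * (1 + γ) := ⟨_, rfl⟩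
  have hP0 : 0 ≤ P := by rw [hP]; positivity
  obtain ⟨ε, hε⟩ : ∃ ε : Bool → ℝ, ε = fun i ↦ if i then 1 else -1 := ⟨_, rfl⟩
  have hε2 (i : Bool) : ε i ^ 2 = 1 := by cases i <;> simp [hε]
  obtain ⟨x, hx⟩ : ∃ x, x = (1 + γ) * (1 + α + β - γ) / Δ := ⟨_, rfl⟩
  obtain ⟨y, hy⟩ : ∃ y, y = (1 + α) * (1 + β + γ - α) / Δ := ⟨_, rfl⟩
  obtain ⟨z, hz⟩ : ∃ z, z = (1 + β) * (1 + α + γ - β) / Δ := ⟨_, rfl⟩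
  obtain ⟨t, ht⟩ : ∃ t, t = √P / (2 * Δ) := ⟨_, rfl⟩
  have ht2 : t ^ 2 = P / (4 * Δ ^ 2) := by
    rw [ht, div_pow, Real.sq_sqrt hP0]; ring
  have hxA : x - y * β - z * α = -1 := by
    rw [hx, hy, hz]; field_simp; rw [hΔ]; ring
  have hxB : -x * β + y - z * γ = -1 := by
    rw [hx, hy, hz]; field_simp; rw [hΔ]; ring
  have hxC : -x * α - y * γ + z = -1 := by
    rw [hx, hy, hz]; field_simp; rw [hΔ]; ring
  have hxyz : x + y + z + 1 = P / Δ := by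
    rw [hx, hy, hz]; field_simp; rw [hΔ, hP]; ring
  have hG (i : Bool) (F : Fin 4 → ℝ) :
      lorentz (x • A + y • B + z • C + (ε i * t) • E) F =
        x * lorentz A F + y * lorentz B F + z * lorentz C F + ε i * t * lorentz E F := by
    simp only [lorentz_add_left, lorentz_smul_left]
  refine ⟨fun i ↦ x • A + y • B + z • C + (ε i * t) • E, fun i ↦ ?_, fun F hF hFA hFB hFC ↦ ?_⟩
  · have gA : lorentz (x • A + y • B + z • C + (ε i * t) • E) A = -1 := by
      rw [hG, hA, hβ', hα', hEA]; linarith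
    have gB : lorentz (x • A + y • B + z • C + (ε i * t) • E) B = -1 := by
      rw [hG, hB, hβ, hγ', hEB]; linarith
    have gC : lorentz (x • A + y • B + z • C + (ε i * t) • E) C = -1 := by
      rw [hG, hC, hα, hγ, hEC]; linarith
    have gE : lorentz (x • A + y • B + z • C + (ε i * t) • E) E = ε i * t * (4 * Δ) := by
      rw [hG, lorentz_comm A, lorentz_comm B, lorentz_comm C, hEA, hEB, hEC, hEE']; ring
    refine ⟨?_, gA, gB, gC⟩
    rw [hG, lorentz_comm A, lorentz_comm B, lorentz_comm C, lorentz_comm E, gA, gB, gC, gE]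
    have : ε i * t * (ε i * t * (4 * Δ)) = P / Δ := by
      calc _ = ε i ^ 2 * t ^ 2 * (4 * Δ) := by ring
        _ = _ := by rw [hε2, ht2]; field_simp
    linarith
  · obtain ⟨h, hh⟩ : ∃ h, lorentz F C = h := ⟨_, rfl⟩
    obtain ⟨q, hq⟩ : ∃ q, q = (1 + β) *
      (1 + β + 2 * α * γ - 2 * h * (α + γ) + h ^ 2 * (1 - β)) := ⟨_, rfl⟩
    obtain ⟨T, hT⟩ : ∃ T, T = (1 + β) * (2 + α + γ - h * (α + γ + 2 * α * γ)) -
      (α - γ) ^ 2 * (1 + h) := ⟨_, rfl⟩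
    have hTxyz : x + y - z * h - h = T / Δ := by
      rw [hx, hy, hz, hT]; field_simp; rw [hΔ]; ring
    have hEF' : lorentz E F ^ 2 = 4 * q := by
      rw [hEF, Matrix.det_succ_row_zero]
      simp [Fin.sum_univ_four, Matrix.det_fin_three, Fin.succAbove, lorentz_comm _ F,
        hA, hB, hC, hα, hβ, hγ, hα', hβ', hγ', hF, hFA, hFB, hh, hq]
      ring
    have hprod : T / Δ ≤ |t * lorentz E F| := by
      rcases le_or_gt T 0 with hT0 | hT0
      · exact (div_nonpos_of_nonpos_of_nonneg hT0 hΔ0.le).trans (abs_nonneg _)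
      · refine (le_abs_self _).trans (sq_le_sq.mp ?_)
        have hle := sq_le_of_tangency_gram hα1 hβ1 hγ1 (hh ▸ hFC) hT hq hT0
        rw [← hP] at hle
        rw [mul_pow, hEF', ht2, div_pow,
          show P / (4 * Δ ^ 2) * (4 * q) = P * q / Δ ^ 2 by field_simp]
        gcongr
    have key (i : Bool) : lorentz (x • A + y • B + z • C + (ε i * t) • E + C) F =
        ε i * (t * lorentz E F) - T / Δ := by
      rw [lorentz_add_left, hG, lorentz_comm A, lorentz_comm B, lorentz_comm C, hFA, hFB, hh]
      linarith
    simp only [key]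
    rcases abs_cases (t * lorentz E F) with ⟨e, -⟩ | ⟨e, -⟩
    · exact ⟨true, by simp only [hε]; simp; linarith⟩
    · exact ⟨false, by simp only [hε]; simp; linarith⟩

/-- The tangency point of the disk `(c, rC)` with a generalized disk tangent to it and to two disks
disjoint from each other and from it is a point of the plane. -/
theorem weight_pos_of_tangent {a b c : Pt} {rA rB rC : ℝ}
    (hrA : 0 < rA) (hrB : 0 < rB) (hrC : 0 < rC) (hAB : rA + rB < dist a b)
    {n : Fin 4 → ℝ} (hn : lorentz n n = 0) (hnA : lorentz n (diskVec a rA) < 0)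
    (hnB : lorentz n (diskVec b rB) < 0) (hnC : lorentz n (diskVec c rC) = 0) : 0 < n 2 := by
  rcases lt_trichotomy (n 2) 0 with hw | hw | hw
  · have inside (q : Pt) (r : ℝ) (hr : 0 < r) (h : lorentz n (diskVec q r) < 0) :
        dist q !₂[n 0 / n 2, n 1 / n 2] < r := by
      by_contra! hd
      rw [lorentz_diskVec_of_null hn hw.ne q hr.ne'] at h
      refine h.not_ge (div_nonneg (mul_nonneg_of_nonpos_of_nonpos hw.le ?_) (by positivity))
      nlinarith
    have := dist_triangle_right a b !₂[n 0 / n 2, n 1 / n 2]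
    linarith [inside a rA hrA hnA, inside b rB hrB hnB]
  · have hsum : n 0 ^ 2 + n 1 ^ 2 = 0 := by
      simp only [lorentz, hw] at hn; linarith
    have h0 : n 0 = 0 := by nlinarith [sq_nonneg (n 0), sq_nonneg (n 1)]
    have h1 : n 1 = 0 := by nlinarith [sq_nonneg (n 0), sq_nonneg (n 1)]
    have h3 : n 3 = 0 := by
      simpa [lorentz, diskVec, h0, h1, hw, hrC.ne'] using hnC
    simp [lorentz, h0, h1, hw, h3] at hnA
  · exact hw

theorem two_point_representation
    (a b c : Pt) (rA rB rC : ℝ)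
    (hrA : 0 < rA) (hrB : 0 < rB) (hrC : 0 < rC)
    (hCA : rC + rA < dist c a) (hCB : rC + rB < dist c b)
    (hAB : rA + rB < dist a b) :
    ∃ R : Finset Pt, R.card ≤ 2 ∧
      ∀ (f : Pt) (ρ : ℝ), 0 ≤ ρ →
        dist f a = ρ + rA → dist f b = ρ + rB →
        (Metric.closedBall f ρ ∩ Metric.closedBall c rC).Nonempty →
        (Metric.closedBall f ρ ∩ (R : Set Pt)).Nonempty := by
  have hCC := lorentz_diskVec_self c hrC.ne'
  have hCA' := lorentz_diskVec_lt_neg_one hrC hrA hCA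
  have hCB' := lorentz_diskVec_lt_neg_one hrC hrB hCB
  obtain ⟨G, hG, hcover⟩ := exists_two_tangent_vectors (lorentz_diskVec_self a hrA.ne')
    (lorentz_diskVec_self b hrB.ne') hCC (lorentz_diskVec_lt_neg_one hrA hrB hAB)
    (by rwa [lorentz_comm]) (by rwa [lorentz_comm])
  obtain ⟨n, hn⟩ : ∃ n : Bool → Fin 4 → ℝ, ∀ i, n i = G i + diskVec c rC := ⟨_, fun _ ↦ rfl⟩
  have hnull (i : Bool) : lorentz (n i) (n i) = 0 := by
    obtain ⟨h1, -, -, h4⟩ := hG i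
    rw [hn, lorentz_add_left, lorentz_add_right, lorentz_add_right, lorentz_comm (diskVec c rC) (G i), h1,
      h4, hCC]
    norm_num
  have hw (i : Bool) : 0 < n i 2 := by
    obtain ⟨-, h2, h3, h4⟩ := hG i
    refine weight_pos_of_tangent hrA hrB hrC hAB (hnull i) ?_ ?_ ?_ (c := c)
    · rw [hn, lorentz_add_left]; linarith
    · rw [hn, lorentz_add_left]; linarith
    · rw [hn, lorentz_add_left, h4, hCC]; norm_num
  classical
  refine ⟨Finset.univ.image fun i ↦ !₂[n i 0 / n i 2, n i 1 / n i 2],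
    Finset.card_image_le, fun f ρ hρ hfa hfb ⟨x, hxf, hxc⟩ ↦ ?_⟩
  have hρ0 : 0 < ρ := by linarith [dist_triangle_left a b f]
  have hfc : dist f c ≤ ρ + rC := by
    rw [Metric.mem_closedBall] at hxf hxc
    linarith [dist_triangle_left f c x]
  obtain ⟨i, hi⟩ := hcover (diskVec f ρ) (lorentz_diskVec_self f hρ0.ne')
    (lorentz_diskVec_of_tangent hρ0 hrA hfa) (lorentz_diskVec_of_tangent hρ0 hrB hfb)
    (neg_one_le_lorentz_diskVec hρ0 hrC hfc)
  refine ⟨!₂[n i 0 / n i 2, n i 1 / n i 2], ?_,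
    Finset.mem_coe.mpr (Finset.mem_image_of_mem _ (Finset.mem_univ i))⟩
  rw [Metric.mem_closedBall, dist_comm]
  by_contra! hd
  rw [← hn, lorentz_diskVec_of_null (hnull i) (hw i).ne' f hρ0.ne'] at hi
  refine hi.not_gt (div_neg_of_neg_of_pos (mul_neg_of_pos_of_neg (hw i) ?_) (by positivity))
  nlinarith
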